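/- arXiv:2312.03287 — 2 statements merged into one kernel-verified Lean document; each statement's English description precedes it below -/
import Mathlib

section
/- Let P^{γαβ} (γ,α,β ∈ {0,1,2}) be constants satisfying the null condition. Then for all sufficiently smooth functions u, v, w supported in the cone K, one has the pointwise estimate on K: |P^{γαβ}∂_γv ∂_αu ∂_βw| ≲ (s²/t²)|∂_tv ∂_tu ∂_tw| + Σ_{a=1,2} { |∂̲_au||∂v||∂w| + |∂u||∂̲_av||∂w| + |∂u||∂v||∂̲_aw| }, where s = √(t²−|x|²) and the implied constant depends only on the P^{γαβ}. -/
open MeasureTheory Real Filter Topology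
open scoped ENNReal NNReal

noncomputable section

/-- A spacetime point in `ℝ^{1+2}`: coordinates `(x₀, x₁, x₂)` with `t = x₀`. -/
abbrev Pt : Type := Fin 3 → ℝ

/-- The `i`-th standard basis vector of `ℝ^{1+2}`. -/
def e3 (i : Fin 3) : Pt := Pi.single i 1

/-- Partial derivative `∂_i`. -/
def pd (i : Fin 3) (u : Pt → ℝ) : Pt → ℝ := fun p => fderiv ℝ u p (e3 i)

/-- Spatial radius `r = |x|`. -/
def rad (p : Pt) : ℝ := Real.sqrt ((p 1) ^ 2 + (p 2) ^ 2)

/-- Hyperbolic time `s = √(t² − |x|²)`. -/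
def sVar (p : Pt) : ℝ := Real.sqrt ((p 0) ^ 2 - (p 1) ^ 2 - (p 2) ^ 2)

/-- The cone `K = {(t,x) : t ≥ 2, |x| < t − 1}`. -/
def Cone : Set Pt := {p | 2 ≤ p 0 ∧ rad p < p 0 - 1}

/-- Lorentz boost `L_a = x_a ∂_t + t ∂_a`, `a ∈ {1,2}`. -/
def Lb (a : Fin 2) (u : Pt → ℝ) : Pt → ℝ :=
  fun p => p a.succ * pd 0 u p + p 0 * pd a.succ u p

/-- Semi-hyperboloidal derivative `∂̲_a = (x_a/t)∂_t + ∂_a`. -/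
def dund (a : Fin 2) (u : Pt → ℝ) : Pt → ℝ :=
  fun p => (p a.succ / p 0) * pd 0 u p + pd a.succ u p

/-- The ordered family `{Γ_k} = {∂₀, ∂₁, ∂₂, L₁, L₂}`. -/
def Gam : Fin 5 → (Pt → ℝ) → (Pt → ℝ) := ![pd 0, pd 1, pd 2, Lb 0, Lb 1]

/-- `Γ^I = Π_k Γ_k^{i_k}` for a multi-index `I ∈ ℕ⁵`. -/
def GamI (I : Fin 5 → ℕ) : (Pt → ℝ) → (Pt → ℝ) :=
  (Gam 0)^[I 0] ∘ (Gam 1)^[I 1] ∘ (Gam 2)^[I 2] ∘ (Gam 3)^[I 3] ∘ (Gam 4)^[I 4]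

/-- Length `|I|` of a multi-index. -/
def mlen (I : Fin 5 → ℕ) : ℕ := ∑ k, I k

/-- The (finite) set of multi-indices `I ∈ ℕ⁵` with `|I| ≤ n`. -/
def midxLe (n : ℕ) : Finset (Fin 5 → ℕ) :=
  (Fintype.piFinset fun _ => Finset.range (n + 1)).filter fun I => mlen I ≤ n

/-- The (finite) set of multi-indices `I ∈ ℕ⁵` with `|I| = 1`. -/
def midxEq1 : Finset (Fin 5 → ℕ) :=
  (Fintype.piFinset fun _ => Finset.range 2).filter fun I => mlen I = 1

/-- `|∂u| = (Σ_α |∂_α u|²)^{1/2}`. -/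
def pdNorm (u : Pt → ℝ) (p : Pt) : ℝ := Real.sqrt (∑ α, (pd α u p) ^ 2)

/-- The wave operator `□ = −∂_t² + ∂₁² + ∂₂²`. -/
def box (u : Pt → ℝ) : Pt → ℝ :=
  fun p => - pd 0 (pd 0 u) p + pd 1 (pd 1 u) p + pd 2 (pd 2 u) p

/-- The null condition for constants `P^{γαβ}`. -/
def NullCond (P : Fin 3 → Fin 3 → Fin 3 → ℝ) : Prop :=
  ∀ ξ : Fin 3 → ℝ, ξ 0 ^ 2 = ξ 1 ^ 2 + ξ 2 ^ 2 →
    ∑ γ, ∑ α, ∑ β, P γ α β * ξ γ * ξ α * ξ β = 0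

/-- The symmetry condition `P^{γαβ} = P^{γβα}`. -/
def SymmCond (P : Fin 3 → Fin 3 → Fin 3 → ℝ) : Prop := ∀ γ α β, P γ α β = P γ β α

/-- Null form `N(w,z) = P^{γαβ} ∂_γ w ∂_α∂_β z`. -/
def Nform (P : Fin 3 → Fin 3 → Fin 3 → ℝ) (w z : Pt → ℝ) : Pt → ℝ :=
  fun p => ∑ γ, ∑ α, ∑ β, P γ α β * pd γ w p * pd α (pd β z) p

/-- The point of the hyperboloid `H_s` above `x ∈ ℝ²`. -/
def hypPt (s : ℝ) (x : Fin 2 → ℝ) : Pt :=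
  ![Real.sqrt (s ^ 2 + (x 0) ^ 2 + (x 1) ^ 2), x 0, x 1]

/-- `‖u‖_{L²_f(H_s)}`. -/
def L2H (u : Pt → ℝ) (s : ℝ) : ℝ :=
  (∫ x : Fin 2 → ℝ, (u (hypPt s x)) ^ 2) ^ (1 / 2 : ℝ)

/-- The hyperboloidal energy `E_m(u,s)`. -/
def Em (m : ℝ) (u : Pt → ℝ) (s : ℝ) : ℝ :=
  ∫ x : Fin 2 → ℝ,
    (((s / hypPt s x 0) * pd 0 u (hypPt s x)) ^ 2
      + ∑ a : Fin 2, (dund a u (hypPt s x)) ^ 2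
      + m ^ 2 * (u (hypPt s x)) ^ 2)

/-- `K₀ = s∂_s + 2x^a∂̲_a`, where `s∂_s = (s²/t)∂_t`. -/
def K0op (u : Pt → ℝ) : Pt → ℝ :=
  fun p => (sVar p) ^ 2 / p 0 * pd 0 u p + 2 * ∑ a : Fin 2, p a.succ * dund a u p

/-- The conformal energy `E_con(u,s)`. -/
def Econ (u : Pt → ℝ) (s : ℝ) : ℝ :=
  ∫ x : Fin 2 → ℝ,
    ((K0op u (hypPt s x) + u (hypPt s x)) ^ 2
      + ∑ a : Fin 2, (s * dund a u (hypPt s x)) ^ 2)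


/-- The trilinear form `P^{γαβ} a_γ b_α c_β`. -/
def trilin (P : Fin 3 → Fin 3 → Fin 3 → ℝ) (a b c : Fin 3 → ℝ) : ℝ :=
  ∑ γ, ∑ α, ∑ β, P γ α β * a γ * b α * c β

/-- The `ℓ¹` norm of the coefficients of a trilinear form. -/
def coeffNorm (P : Fin 3 → Fin 3 → Fin 3 → ℝ) : ℝ := ∑ γ, ∑ α, ∑ β, |P γ α β|

theorem coeffNorm_nonneg (P : Fin 3 → Fin 3 → Fin 3 → ℝ) : 0 ≤ coeffNorm P := by
  unfold coeffNorm
  positivity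

theorem abs_trilin_le (P : Fin 3 → Fin 3 → Fin 3 → ℝ) {a b c : Fin 3 → ℝ} {A B C : ℝ}
    (ha : ∀ i, |a i| ≤ A) (hb : ∀ i, |b i| ≤ B) (hc : ∀ i, |c i| ≤ C) :
    |trilin P a b c| ≤ coeffNorm P * (A * B * C) := by
  have hA : 0 ≤ A := (abs_nonneg _).trans (ha 0)
  have hB : 0 ≤ B := (abs_nonneg _).trans (hb 0)
  unfold trilin coeffNorm
  simp only [Finset.sum_mul]
  refine (Finset.abs_sum_le_sum_abs _ _).trans (Finset.sum_le_sum fun γ _ => ?_)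
  refine (Finset.abs_sum_le_sum_abs _ _).trans (Finset.sum_le_sum fun α _ => ?_)
  refine (Finset.abs_sum_le_sum_abs _ _).trans (Finset.sum_le_sum fun β _ => ?_)
  rw [mul_assoc, mul_assoc, abs_mul, abs_mul, abs_mul, ← mul_assoc |a γ|]
  gcongr
  exacts [ha γ, hb α, hc β]

/-- Telescoping of a trilinear form along perturbations of its three arguments. -/
theorem trilin_sub_trilin (P : Fin 3 → Fin 3 → Fin 3 → ℝ) (a b c a' b' c' : Fin 3 → ℝ) :
    trilin P a b c - trilin P a' b' c' =
      trilin P (a - a') b c + trilin P a' (b - b') c + trilin P a' b' (c - c') := by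
  simp only [trilin, ← Finset.sum_sub_distrib, ← Finset.sum_add_distrib, Pi.sub_apply]
  refine Finset.sum_congr rfl fun γ _ => Finset.sum_congr rfl fun α _ =>
    Finset.sum_congr rfl fun β _ => ?_
  ring

theorem trilin_smul (P : Fin 3 → Fin 3 → Fin 3 → ℝ) (k l m : ℝ) (a : Fin 3 → ℝ) :
    trilin P (k • a) (l • a) (m • a) = k * l * m * trilin P a a a := by
  simp only [trilin, Finset.mul_sum, Pi.smul_apply, smul_eq_mul]
  refine Finset.sum_congr rfl fun γ _ => Finset.sum_congr rfl fun α _ =>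
    Finset.sum_congr rfl fun β _ => ?_
  ring

/-- Under the null condition the cubic form at `(1, -y)` is controlled by `1 - |y|²`. -/
theorem NullCond.abs_trilin_self_le {P : Fin 3 → Fin 3 → Fin 3 → ℝ} (hP : NullCond P)
    {y z : ℝ} (h : y ^ 2 + z ^ 2 ≤ 1) :
    |trilin P ![1, -y, -z] ![1, -y, -z] ![1, -y, -z]| ≤
      3 * coeffNorm P * (1 - y ^ 2 - z ^ 2) := by
  set r := √(y ^ 2 + z ^ 2) with hr
  have hr0 : 0 ≤ r := Real.sqrt_nonneg _
  have hr2 : r ^ 2 = y ^ 2 + z ^ 2 := Real.sq_sqrt (by positivity)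
  have hr1 : r ≤ 1 := by nlinarith
  have hy : |y| ≤ 1 := (sq_le_one_iff_abs_le_one y).1 (by linarith [sq_nonneg z])
  have hz : |z| ≤ 1 := (sq_le_one_iff_abs_le_one z).1 (by linarith [sq_nonneg y])
  have hnull : trilin P ![r, -y, -z] ![r, -y, -z] ![r, -y, -z] = 0 :=
    hP ![r, -y, -z] (by simpa using hr2)
  have h1 : ∀ i, |(![1, -y, -z] : Fin 3 → ℝ) i| ≤ 1 := by
    intro i; fin_cases i <;> simp [hy, hz]
  have h2 : ∀ i, |(![r, -y, -z] : Fin 3 → ℝ) i| ≤ 1 := by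
    intro i; fin_cases i <;> simp [hy, hz, abs_of_nonneg hr0, hr1]
  have h3 : ∀ i, |((![1, -y, -z] : Fin 3 → ℝ) - ![r, -y, -z]) i| ≤ 1 - r := by
    intro i; fin_cases i <;> simp [abs_of_nonneg (sub_nonneg.2 hr1), hr1]
  have key := trilin_sub_trilin P ![1, -y, -z] ![1, -y, -z] ![1, -y, -z]
    ![r, -y, -z] ![r, -y, -z] ![r, -y, -z]
  rw [hnull, sub_zero] at key
  rw [key]
  refine (abs_add_three _ _ _).trans ?_
  have e1 := abs_trilin_le P h3 h1 h1
  have e2 := abs_trilin_le P h2 h3 h1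
  have e3 := abs_trilin_le P h2 h2 h3
  have hle : coeffNorm P * (1 - r) ≤ coeffNorm P * (1 - y ^ 2 - z ^ 2) :=
    mul_le_mul_of_nonneg_left (by nlinarith) (coeffNorm_nonneg P)
  linarith

theorem abs_pd_le_pdNorm (u : Pt → ℝ) (p : Pt) (i : Fin 3) : |pd i u p| ≤ pdNorm u p :=
  Real.abs_le_sqrt (Finset.single_le_sum (f := fun α => (pd α u p) ^ 2)
    (fun _ _ => sq_nonneg _) (Finset.mem_univ i))

/-- The gradient differs from its component along `(1, -x/t)` by semi-hyperboloidal
derivatives. -/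
theorem abs_pd_sub_le_sum_dund (u : Pt → ℝ) (p : Pt) (i : Fin 3) :
    |((fun j => pd j u p) - pd 0 u p • ![1, -(p 1 / p 0), -(p 2 / p 0)]) i| ≤
      ∑ a : Fin 2, |dund a u p| := by
  have h1 : dund 0 u p = pd 1 u p + pd 0 u p * (p 1 / p 0) := by
    simp only [dund, Fin.succ_zero_eq_one]; ring
  have h2 : dund 1 u p = pd 2 u p + pd 0 u p * (p 2 / p 0) := by
    simp only [dund, Fin.succ_one_eq_two]; ring
  rw [Fin.sum_univ_two, h1, h2]
  fin_cases i
  · simpa using by positivity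
  · simp
  · simp

theorem Cone.pos_and_lt {p : Pt} (hp : p ∈ Cone) :
    0 < p 0 ∧ (p 1) ^ 2 + (p 2) ^ 2 < (p 0) ^ 2 := by
  obtain ⟨h2, hr⟩ := hp
  have h0 : 0 < p 0 := by linarith
  exact ⟨h0, (Real.sqrt_lt' h0).1 (by unfold rad at hr; linarith)⟩

/-- estimate of the trilinear null form `P^{γαβ}∂_γv ∂_αu ∂_βw`. -/
theorem nullform_estimate_trilinear
    (P : Fin 3 → Fin 3 → Fin 3 → ℝ) (hP : NullCond P) :
    ∃ C > (0:ℝ), ∀ u v w : Pt → ℝ,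
      ContDiff ℝ (⊤ : ℕ∞) u → ContDiff ℝ (⊤ : ℕ∞) v → ContDiff ℝ (⊤ : ℕ∞) w →
      Function.support u ⊆ Cone → Function.support v ⊆ Cone →
      Function.support w ⊆ Cone →
      ∀ p ∈ Cone,
        |∑ γ, ∑ α, ∑ β, P γ α β * pd γ v p * pd α u p * pd β w p| ≤
          C * ((sVar p) ^ 2 / (p 0) ^ 2 * |pd 0 v p * pd 0 u p * pd 0 w p|
            + ∑ a : Fin 2,
                (|dund a u p| * pdNorm v p * pdNorm w p
                  + pdNorm u p * |dund a v p| * pdNorm w p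
                  + pdNorm u p * pdNorm v p * |dund a w p|)) := by
  have hM := coeffNorm_nonneg P
  refine ⟨3 * coeffNorm P + 1, by positivity, fun u v w _ _ _ _ _ _ p hp => ?_⟩
  obtain ⟨h0, hlt⟩ := Cone.pos_and_lt hp
  have hs : sVar p ^ 2 / p 0 ^ 2 = 1 - (p 1 / p 0) ^ 2 - (p 2 / p 0) ^ 2 := by
    rw [sVar, Real.sq_sqrt (by linarith)]
    field_simp
  have hs0 : 0 ≤ sVar p ^ 2 / p 0 ^ 2 := by positivity
  have hyz : (p 1 / p 0) ^ 2 + (p 2 / p 0) ^ 2 ≤ 1 := by linarith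
  set η : Fin 3 → ℝ := ![1, -(p 1 / p 0), -(p 2 / p 0)] with hη
  have hmain : |trilin P η η η| ≤ 3 * coeffNorm P * (sVar p ^ 2 / p 0 ^ 2) := by
    rw [hs]
    exact hP.abs_trilin_self_le hyz
  have hη1 : ∀ i, |η i| ≤ 1 := by
    intro i
    fin_cases i
    · simp [hη]
    · simpa [hη] using (sq_le_one_iff_abs_le_one (p 1 / p 0)).1
        (by linarith [sq_nonneg (p 2 / p 0)])
    · simpa [hη] using (sq_le_one_iff_abs_le_one (p 2 / p 0)).1
        (by linarith [sq_nonneg (p 1 / p 0)])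
  have hsmul : ∀ f : Pt → ℝ, ∀ i, |(pd 0 f p • η) i| ≤ pdNorm f p := by
    intro f i
    rw [Pi.smul_apply, smul_eq_mul, abs_mul]
    exact (mul_le_of_le_one_right (abs_nonneg _) (hη1 i)).trans (abs_pd_le_pdNorm f p 0)
  have key := trilin_sub_trilin P (fun i => pd i v p) (fun i => pd i u p) (fun i => pd i w p)
    (pd 0 v p • η) (pd 0 u p • η) (pd 0 w p • η)
  rw [trilin_smul, sub_eq_iff_eq_add'] at key
  change |trilin P (fun i => pd i v p) (fun i => pd i u p) (fun i => pd i w p)| ≤ _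
  rw [key]
  have e1 := abs_trilin_le P (abs_pd_sub_le_sum_dund v p) (abs_pd_le_pdNorm u p)
    (abs_pd_le_pdNorm w p)
  have e2 := abs_trilin_le P (hsmul v) (abs_pd_sub_le_sum_dund u p) (abs_pd_le_pdNorm w p)
  have e3 := abs_trilin_le P (hsmul v) (hsmul u) (abs_pd_sub_le_sum_dund w p)
  have e0 := mul_le_mul_of_nonneg_left hmain (abs_nonneg (pd 0 v p * pd 0 u p * pd 0 w p))
  rw [← abs_mul] at e0
  refine (abs_add_le _ _).trans ((add_le_add_right (abs_add_three _ _ _) _).trans ?_)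
  have hU : 0 ≤ pdNorm u p := Real.sqrt_nonneg _
  have hV : 0 ≤ pdNorm v p := Real.sqrt_nonneg _
  have hW : 0 ≤ pdNorm w p := Real.sqrt_nonneg _
  set S := ∑ a : Fin 2, (|dund a u p| * pdNorm v p * pdNorm w p
    + pdNorm u p * |dund a v p| * pdNorm w p + pdNorm u p * pdNorm v p * |dund a w p|) with hS
  have hS0 : 0 ≤ S := by positivity
  have hsum : (∑ a : Fin 2, |dund a v p|) * pdNorm u p * pdNorm w p
      + pdNorm v p * (∑ a : Fin 2, |dund a u p|) * pdNorm w p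
      + pdNorm v p * pdNorm u p * (∑ a : Fin 2, |dund a w p|) = S := by
    simp only [hS, Fin.sum_univ_two]
    ring
  have hT : 0 ≤ sVar p ^ 2 / p 0 ^ 2 * |pd 0 v p * pd 0 u p * pd 0 w p| := by positivity
  have hMS : 0 ≤ coeffNorm P * S := by positivity
  rw [← hsum] at hMS hS0 ⊢
  linarith
end
end

section
/- Let (u,v) be a sufficiently smooth solution of the system (WKG), and set F_u := N₁(v,v) + N₂(u,v). Then the function ṽ := v − N₂(u,u) satisfies the identity -□ṽ + ṽ = N₁(v,u) − N₂(F_u, u) − N₂(u, F_u) − 2(N₂(∂_tu, ∂_tu) − Σ_{a=1,2} N₂(∂_au, ∂_au)), where for functions w, z we write N_i(w,z) = P_i^{γαβ}∂_γw∂_α∂_βz. -/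
open MeasureTheory Real Filter Topology
open scoped ENNReal NNReal

noncomputable section

theorem contDiff_pd (i : Fin 3) {f : Pt → ℝ} (hf : ContDiff ℝ (⊤ : ℕ∞) f) :
    ContDiff ℝ (⊤ : ℕ∞) (pd i f) :=
  (hf.fderiv_right (m := (⊤ : ℕ∞)) (by simp)).clm_apply contDiff_const

theorem ContDiff.differentiable_top {f : Pt → ℝ} (hf : ContDiff ℝ (⊤ : ℕ∞) f) :
    Differentiable ℝ f :=
  hf.differentiable (by simp)

theorem pd_add (i : Fin 3) {f g : Pt → ℝ} (hf : Differentiable ℝ f)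
    (hg : Differentiable ℝ g) : pd i (f + g) = pd i f + pd i g := by
  funext p
  simp [pd, fderiv_add (hf p) (hg p)]

theorem pd_sub (i : Fin 3) {f g : Pt → ℝ} (hf : Differentiable ℝ f)
    (hg : Differentiable ℝ g) : pd i (f - g) = pd i f - pd i g := by
  funext p
  simp [pd, fderiv_sub (hf p) (hg p)]

theorem pd_neg (i : Fin 3) (f : Pt → ℝ) : pd i (-f) = -pd i f := by
  funext p
  simp [pd, fderiv_neg]

theorem pd_comm (i j : Fin 3) {f : Pt → ℝ} (hf : ContDiff ℝ (⊤ : ℕ∞) f) :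
    pd i (pd j f) = pd j (pd i f) := by
  funext p
  have hd : DifferentiableAt ℝ (fderiv ℝ f) p :=
    (hf.fderiv_right (m := (⊤ : ℕ∞)) (by simp)).differentiable (by simp) p
  have hsymm : IsSymmSndFDerivAt ℝ f p :=
    hf.contDiffAt.isSymmSndFDerivAt (by
      rw [minSmoothness_of_isRCLikeNormedField]
      exact WithTop.coe_le_coe.2 (le_top (a := (2 : ℕ∞))))
  have key (a b : Fin 3) : pd a (pd b f) p = fderiv ℝ (fderiv ℝ f) p (e3 a) (e3 b) := by
    unfold pd
    rw [fderiv_clm_apply hd (differentiableAt_const _)]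
    simp
  rw [key, key, hsymm.eq]

theorem contDiff_nform (P : Fin 3 → Fin 3 → Fin 3 → ℝ) {w z : Pt → ℝ}
    (hw : ContDiff ℝ (⊤ : ℕ∞) w) (hz : ContDiff ℝ (⊤ : ℕ∞) z) :
    ContDiff ℝ (⊤ : ℕ∞) (Nform P w z) := by
  unfold Nform
  exact ContDiff.sum fun γ _ => ContDiff.sum fun α _ => ContDiff.sum fun β _ =>
    (contDiff_const.mul (contDiff_pd γ hw)).mul (contDiff_pd α (contDiff_pd β hz))

/-- The Leibniz rule for the form `Nform`. -/
theorem pd_nform (i : Fin 3) (P : Fin 3 → Fin 3 → Fin 3 → ℝ) {w z : Pt → ℝ}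
    (hw : ContDiff ℝ (⊤ : ℕ∞) w) (hz : ContDiff ℝ (⊤ : ℕ∞) z) :
    pd i (Nform P w z) = Nform P (pd i w) z + Nform P w (pd i z) := by
  funext p
  have hderiv (γ α β : Fin 3) :=
    (((contDiff_pd γ hw).differentiable_top p).hasFDerivAt.const_mul (P γ α β)).mul
      ((contDiff_pd α (contDiff_pd β hz)).differentiable_top p).hasFDerivAt
  have hsum := HasFDerivAt.fun_sum (u := Finset.univ) fun γ _ =>
    HasFDerivAt.fun_sum (u := Finset.univ) fun α _ =>
      HasFDerivAt.fun_sum (u := Finset.univ) fun β _ => hderiv γ α β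
  have hpd : pd i (Nform P w z) p = _ := congrArg (fun L => L (e3 i)) hsum.fderiv
  rw [hpd]
  simp only [Nform, Pi.add_apply, ← Finset.sum_add_distrib, _root_.sum_apply]
  refine Finset.sum_congr rfl fun γ _ => Finset.sum_congr rfl fun α _ =>
    Finset.sum_congr rfl fun β _ => ?_
  rw [pd_comm γ i hw, pd_comm β i hz, pd_comm α i (contDiff_pd β hz)]
  simp only [_root_.add_apply, _root_.smul_apply, smul_eq_mul]
  change P γ α β * pd γ w p * pd i (pd α (pd β z)) p +
    pd α (pd β z) p * (P γ α β * pd i (pd γ w) p) = _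
  ring

theorem nform_add_left (P : Fin 3 → Fin 3 → Fin 3 → ℝ) {w w' : Pt → ℝ} (z : Pt → ℝ)
    (hw : Differentiable ℝ w) (hw' : Differentiable ℝ w') :
    Nform P (w + w') z = Nform P w z + Nform P w' z := by
  funext p
  simp only [Nform, pd_add _ hw hw', Pi.add_apply, ← Finset.sum_add_distrib, mul_add, add_mul]

theorem nform_neg_left (P : Fin 3 → Fin 3 → Fin 3 → ℝ) (w z : Pt → ℝ) :
    Nform P (-w) z = -Nform P w z := by
  funext p
  simp [Nform, pd_neg]

theorem nform_add_right (P : Fin 3 → Fin 3 → Fin 3 → ℝ) (w : Pt → ℝ) {z z' : Pt → ℝ}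
    (hz : ContDiff ℝ (⊤ : ℕ∞) z) (hz' : ContDiff ℝ (⊤ : ℕ∞) z') :
    Nform P w (z + z') = Nform P w z + Nform P w z' := by
  funext p
  simp only [Nform, pd_add _ hz.differentiable_top hz'.differentiable_top,
    pd_add _ (contDiff_pd _ hz).differentiable_top (contDiff_pd _ hz').differentiable_top,
    Pi.add_apply, ← Finset.sum_add_distrib, mul_add]

theorem nform_neg_right (P : Fin 3 → Fin 3 → Fin 3 → ℝ) (w z : Pt → ℝ) :
    Nform P w (-z) = -Nform P w z := by
  funext p
  simp [Nform, pd_neg]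

theorem pd_pd_nform (i : Fin 3) (P : Fin 3 → Fin 3 → Fin 3 → ℝ) {w z : Pt → ℝ}
    (hw : ContDiff ℝ (⊤ : ℕ∞) w) (hz : ContDiff ℝ (⊤ : ℕ∞) z) (p : Pt) :
    pd i (pd i (Nform P w z)) p = Nform P (pd i (pd i w)) z p
      + 2 * Nform P (pd i w) (pd i z) p + Nform P w (pd i (pd i z)) p := by
  have hw' := contDiff_pd i hw
  have hz' := contDiff_pd i hz
  rw [pd_nform i P hw hz, pd_add i (contDiff_nform P hw' hz).differentiable_top
    (contDiff_nform P hw hz').differentiable_top, pd_nform i P hw' hz, pd_nform i P hw hz']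
  simp only [Pi.add_apply]
  ring

theorem box_eq (f : Pt → ℝ) :
    box f = -pd 0 (pd 0 f) + pd 1 (pd 1 f) + pd 2 (pd 2 f) := rfl

theorem box_sub {f g : Pt → ℝ} (hf : ContDiff ℝ (⊤ : ℕ∞) f) (hg : ContDiff ℝ (⊤ : ℕ∞) g) :
    box (f - g) = box f - box g := by
  have h (i : Fin 3) : pd i (pd i (f - g)) = pd i (pd i f) - pd i (pd i g) := by
    rw [pd_sub i hf.differentiable_top hg.differentiable_top,
      pd_sub i (contDiff_pd i hf).differentiable_top (contDiff_pd i hg).differentiable_top]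
  simp only [box_eq, h]
  ring

/-- The wave operator applied to `Nform P w z`. -/
theorem box_nform (P : Fin 3 → Fin 3 → Fin 3 → ℝ) {w z : Pt → ℝ}
    (hw : ContDiff ℝ (⊤ : ℕ∞) w) (hz : ContDiff ℝ (⊤ : ℕ∞) z) (p : Pt) :
    box (Nform P w z) p = Nform P (box w) z p + Nform P w (box z) p
      - 2 * (Nform P (pd 0 w) (pd 0 z) p
        - ∑ a : Fin 2, Nform P (pd a.succ w) (pd a.succ z) p) := by
  have hw2 (i : Fin 3) := contDiff_pd i (contDiff_pd i hw)
  have hz2 (i : Fin 3) := contDiff_pd i (contDiff_pd i hz)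
  have hw01 : ContDiff ℝ (⊤ : ℕ∞) (-pd 0 (pd 0 w) + pd 1 (pd 1 w)) :=
    (hw2 0).neg.add (hw2 1)
  have hw0 : ContDiff ℝ (⊤ : ℕ∞) (-pd 0 (pd 0 w)) := (hw2 0).neg
  have hleft : Nform P (box w) z = -Nform P (pd 0 (pd 0 w)) z + Nform P (pd 1 (pd 1 w)) z
      + Nform P (pd 2 (pd 2 w)) z := by
    rw [box_eq, nform_add_left P z hw01.differentiable_top
      (hw2 2).differentiable_top, nform_add_left P z hw0.differentiable_top
      (hw2 1).differentiable_top, nform_neg_left]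
  have hz01 : ContDiff ℝ (⊤ : ℕ∞) (-pd 0 (pd 0 z) + pd 1 (pd 1 z)) :=
    (hz2 0).neg.add (hz2 1)
  have hz0 : ContDiff ℝ (⊤ : ℕ∞) (-pd 0 (pd 0 z)) := (hz2 0).neg
  have hright : Nform P w (box z) = -Nform P w (pd 0 (pd 0 z)) + Nform P w (pd 1 (pd 1 z))
      + Nform P w (pd 2 (pd 2 z)) := by
    rw [box_eq, nform_add_right P w hz01 (hz2 2),
      nform_add_right P w hz0 (hz2 1), nform_neg_right]
  rw [hleft, hright, box]
  simp only [pd_pd_nform _ P hw hz, Pi.add_apply, Pi.neg_apply, Fin.sum_univ_two,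
    Fin.succ_zero_eq_one, Fin.succ_one_eq_two]
  ring

/-- the identity satisfied by the nonlinear transform `ṽ = v − N₂(u,u)`. -/
theorem tilde_v_identity
    (P1 P2 : Fin 3 → Fin 3 → Fin 3 → ℝ)
    (hP1 : NullCond P1) (hP2 : NullCond P2)
    (hS1 : SymmCond P1) (hS2 : SymmCond P2)
    (u v : Pt → ℝ)
    (hu : ContDiff ℝ (⊤ : ℕ∞) u) (hv : ContDiff ℝ (⊤ : ℕ∞) v)
    (heq1 : ∀ p : Pt, - box u p = Nform P1 v v p + Nform P2 u v p)
    (heq2 : ∀ p : Pt, - box v p + v p = Nform P1 v u p + Nform P2 u u p) :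
    ∀ p : Pt,
      - box (fun q => v q - Nform P2 u u q) p + (v p - Nform P2 u u p) =
        Nform P1 v u p
          - Nform P2 (fun q => Nform P1 v v q + Nform P2 u v q) u p
          - Nform P2 u (fun q => Nform P1 v v q + Nform P2 u v q) p
          - 2 * (Nform P2 (pd 0 u) (pd 0 u) p
              - ∑ a : Fin 2, Nform P2 (pd a.succ u) (pd a.succ u) p) := by
  intro p
  have hF : (fun q => Nform P1 v v q + Nform P2 u v q) = -box u :=
    funext fun q => (heq1 q).symm
  have hsub : box (fun q => v q - Nform P2 u u q) p = box v p - box (Nform P2 u u) p :=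
    congrFun (box_sub hv (contDiff_nform P2 hu hu)) p
  rw [hF, hsub, box_nform P2 hu hu, nform_neg_left, nform_neg_right]
  simp only [Pi.neg_apply]
  linarith [heq2 p]
end
end
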